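/- Let two ellipses have semiaxes a₁ ≥ b₁ > 0 and a₂ ≥ b₂ > 0. If a₁² + b₁² = a₂² + b₂² and the two ellipses have equal circumference (perimeter), then a₁ = a₂ and b₁ = b₂, i.e. the ellipses are isometric. -/

import Mathlib

open Real intervalIntegral

noncomputable section

/-- Circumference of the ellipse with semiaxes `A`, `B`. -/
def ellipsePerim (A B : ℝ) : ℝ :=
  ∫ t in (0:ℝ)..(2*π), Real.sqrt (A^2 * Real.cos t ^ 2 + B^2 * Real.sin t ^ 2)

theorem ellipsePerim_swap (A B : ℝ) : ellipsePerim A B = ellipsePerim B A := by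
  unfold ellipsePerim
  have hp : Function.Periodic
      (fun t : ℝ => Real.sqrt (A^2 * Real.cos t ^ 2 + B^2 * Real.sin t ^ 2)) (2*π) := by
    intro t
    simp only [Real.cos_add_two_pi, Real.sin_add_two_pi]
  have h1 := hp.intervalIntegral_add_eq 0 (π/2)
  have h2 := intervalIntegral.integral_comp_add_right (a := 0) (b := 2*π)
    (fun t : ℝ => Real.sqrt (A^2 * Real.cos t ^ 2 + B^2 * Real.sin t ^ 2)) (π/2)
  rw [zero_add] at h1
  rw [h1, show π/2 + 2*π = 2*π + π/2 by ring]
  rw [zero_add] at h2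
  rw [← h2]
  congr 1
  funext t
  rw [Real.cos_add_pi_div_two, Real.sin_add_pi_div_two]
  congr 1
  ring

theorem two_ellipsePerim (A B : ℝ) : 2 * ellipsePerim A B =
    ∫ t in (0:ℝ)..(2*π), (Real.sqrt (A^2 * Real.cos t ^ 2 + B^2 * Real.sin t ^ 2)
      + Real.sqrt (B^2 * Real.cos t ^ 2 + A^2 * Real.sin t ^ 2)) := by
  rw [intervalIntegral.integral_add]
  · have := ellipsePerim_swap A B
    unfold ellipsePerim at *
    linarith
  · exact Continuous.intervalIntegrable (by fun_prop) _ _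
  · exact Continuous.intervalIntegrable (by fun_prop) _ _

theorem sum_sqrt_sq (A B c s : ℝ) (h : s^2 + c^2 = 1) :
    (Real.sqrt (A^2 * c ^ 2 + B^2 * s ^ 2) + Real.sqrt (B^2 * c ^ 2 + A^2 * s ^ 2))^2
      = (A^2 + B^2) + 2 * Real.sqrt (A^2*B^2*(c^2-s^2)^2 + (A^2+B^2)^2*(c^2*s^2)) := by
  have hu : 0 ≤ A^2 * c ^ 2 + B^2 * s ^ 2 := by positivity
  have hv : 0 ≤ B^2 * c ^ 2 + A^2 * s ^ 2 := by positivity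
  rw [show A^2*B^2*(c^2-s^2)^2 + (A^2+B^2)^2*(c^2*s^2)
    = (A^2 * c ^ 2 + B^2 * s ^ 2) * (B^2 * c ^ 2 + A^2 * s ^ 2) by ring, Real.sqrt_mul hu]
  have e1 := Real.sq_sqrt hu
  have e2 := Real.sq_sqrt hv
  linear_combination e1 + e2 + (A^2+B^2) * h

theorem ellipsePerim_lt (a₁ b₁ a₂ b₂ : ℝ) (hsum : a₁^2 + b₁^2 = a₂^2 + b₂^2)
    (hlt : a₁^2*b₁^2 < a₂^2*b₂^2) : ellipsePerim a₁ b₁ < ellipsePerim a₂ b₂ := by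
  suffices h : 2 * ellipsePerim a₁ b₁ < 2 * ellipsePerim a₂ b₂ by linarith
  rw [two_ellipsePerim, two_ellipsePerim]
  apply intervalIntegral.integral_lt_integral_of_continuousOn_of_le_of_exists_lt
  · positivity
  · exact Continuous.continuousOn (by fun_prop)
  · exact Continuous.continuousOn (by fun_prop)
  · intro t _
    refine (pow_le_pow_iff_left₀ (by positivity) (by positivity) two_ne_zero).1 ?_
    rw [sum_sqrt_sq _ _ _ _ (Real.sin_sq_add_cos_sq t),
      sum_sqrt_sq _ _ _ _ (Real.sin_sq_add_cos_sq t), hsum]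
    gcongr
  · refine ⟨0, ⟨le_refl _, by positivity⟩, ?_⟩
    apply lt_of_pow_lt_pow_left₀ 2 (by positivity)
    rw [sum_sqrt_sq _ _ _ _ (Real.sin_sq_add_cos_sq 0),
      sum_sqrt_sq _ _ _ _ (Real.sin_sq_add_cos_sq 0), hsum]
    have : Real.sqrt (a₁^2*b₁^2) < Real.sqrt (a₂^2*b₂^2) :=
      Real.sqrt_lt_sqrt (by positivity) hlt
    simpa using this

/-- two ellipses with `a₁² + b₁² = a₂² + b₂²` and equal circumference
are isometric: `a₁ = a₂` and `b₁ = b₂`. -/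
theorem ellipses_equal_sum_and_perimeter_isometric
    (a₁ b₁ a₂ b₂ : ℝ) (hb₁ : 0 < b₁) (h₁ : b₁ ≤ a₁) (hb₂ : 0 < b₂) (h₂ : b₂ ≤ a₂)
    (hsum : a₁^2 + b₁^2 = a₂^2 + b₂^2)
    (hperim : ellipsePerim a₁ b₁ = ellipsePerim a₂ b₂) :
    a₁ = a₂ ∧ b₁ = b₂ := by
  have hprod : a₁^2*b₁^2 = a₂^2*b₂^2 := by
    rcases lt_trichotomy (a₁^2*b₁^2) (a₂^2*b₂^2) with h | h | h
    · exact absurd hperim (ellipsePerim_lt _ _ _ _ hsum h).ne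
    · exact h
    · exact absurd hperim (ellipsePerim_lt _ _ _ _ hsum.symm h).ne'
  have ha₁ : 0 < a₁ := lt_of_lt_of_le hb₁ h₁
  have ha₂ : 0 < a₂ := lt_of_lt_of_le hb₂ h₂
  have hp : a₁*b₁ = a₂*b₂ := by
    refine (pow_left_inj₀ (by positivity) (by positivity) two_ne_zero).1 ?_
    rw [mul_pow, mul_pow, hprod]
  have hs : a₁ + b₁ = a₂ + b₂ := by
    refine (pow_left_inj₀ (by positivity) (by positivity) two_ne_zero).1 ?_
    linear_combination hsum + 2 * hp
  have hd : a₁ - b₁ = a₂ - b₂ := by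
    refine (pow_left_inj₀ (by linarith) (by linarith) two_ne_zero).1 ?_
    linear_combination hsum - 2 * hp
  constructor <;> linarith
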